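/- (Characterization of 'really badly behaved' two-variable semidefinite systems.) Let A₁, A₂, B be linearly independent real symmetric n×n matrices with B = I_r ⊕ 0_{n−r} for some 0 ≤ r < n, such that the system x₁A₁ + x₂A₂ ⪯ B is feasible and every positive semidefinite slack B − x₁A₁ − x₂A₂ has rank at most r. Then there exists c ∈ ℝ² with val(P) < val(D) if and only if there are an invertible T ∈ ℝ^{n×n}, an invertible V ∈ ℝ^{2×2} and μ ∈ ℝ² such that, setting A_i' = Tᵀ(∑ⱼ V_{ij}Aⱼ)T and B' = Tᵀ(B + ∑ⱼ μⱼAⱼ)T, there are integers p, r', s with 1 ≤ p ≤ r' < n, s ≥ 0, r' + s < n for which B' = I_{r'} ⊕ 0, A₁' = Λ ⊕ 0 with Λ a p×p positive definite diagonal matrix, and with respect to the block partition of sizes p, r'−p, s, n−r'−s the matrix A₂' has (2,2) block a diagonal matrix Σ, (3,3) block −I_s, (1,4) block a matrix M ≠ 0, arbitrary (1,1), (1,2), (1,3) blocks (and their symmetric counterparts), and all remaining blocks zero. -/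

import Mathlib

open Matrix

/-- The optimal value of the primal SDP (P). -/
noncomputable def valP {n m : ℕ} (A : Fin m → Matrix (Fin n) (Fin n) ℝ)
    (B : Matrix (Fin n) (Fin n) ℝ) (c : Fin m → ℝ) : EReal :=
  sSup ((fun x : Fin m → ℝ => ((∑ i, c i * x i : ℝ) : EReal)) ''
    {x | (B - ∑ i, x i • A i).PosSemidef})

/-- The optimal value of the dual SDP (D). -/
noncomputable def valD {n m : ℕ} (A : Fin m → Matrix (Fin n) (Fin n) ℝ)
    (B : Matrix (Fin n) (Fin n) ℝ) (c : Fin m → ℝ) : EReal :=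
  sInf ((fun Y : Matrix (Fin n) (Fin n) ℝ => (((B * Y).trace : ℝ) : EReal)) ''
    {Y | Y.PosSemidef ∧ ∀ i, ((A i) * Y).trace = c i})

/-- A two-variable semidefinite *system* `(A₁, A₂, B)` is in standard form:
there are integers `p, r', s` with `1 ≤ p ≤ r' < n`, `s ≥ 0`, `r' + s < n` such that
`B = I_{r'} ⊕ 0`, `A₁ = Λ ⊕ 0` with `Λ` a `p×p` positive definite diagonal matrix, and
with respect to the block partition of sizes `p, r'-p, s, n-r'-s` the matrix `A₂`
has `(2,2)` block a diagonal matrix, `(3,3)` block `-I_s`, `(1,4)` block nonzero,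
arbitrary `(1,1)`, `(1,2)`, `(1,3)` blocks (and symmetric counterparts), and all
remaining blocks zero. -/
def StandardFormSys {n : ℕ} (A1 A2 B : Matrix (Fin n) (Fin n) ℝ) : Prop :=
  A1.IsSymm ∧ A2.IsSymm ∧
  ∃ p r' s : ℕ, 1 ≤ p ∧ p ≤ r' ∧ r' < n ∧ r' + s < n ∧
    (∀ a b : Fin n, B a b = if a = b ∧ a.val < r' then 1 else 0) ∧
    (∀ a b : Fin n, a ≠ b → A1 a b = 0) ∧
    (∀ a : Fin n, a.val < p → 0 < A1 a a) ∧
    (∀ a : Fin n, p ≤ a.val → A1 a a = 0) ∧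
    (∀ a b : Fin n, p ≤ a.val → a.val < r' → p ≤ b.val → b.val < r' → a ≠ b → A2 a b = 0) ∧
    (∀ a b : Fin n, r' ≤ a.val → a.val < r' + s → r' ≤ b.val → b.val < r' + s →
      A2 a b = if a = b then -1 else 0) ∧
    (∃ a b : Fin n, a.val < p ∧ r' + s ≤ b.val ∧ A2 a b ≠ 0) ∧
    (∀ a b : Fin n, p ≤ a.val → a.val < r' → r' ≤ b.val → A2 a b = 0) ∧
    (∀ a b : Fin n, r' ≤ a.val → a.val < r' + s → r' + s ≤ b.val → A2 a b = 0) ∧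
    (∀ a b : Fin n, r' + s ≤ a.val → r' + s ≤ b.val → A2 a b = 0)


/-- The relations between a family `b`, split into four classes by `k`, and three symmetric
operators that make up the standard form of a two-variable semidefinite system. -/
structure IsAdaptedFamily {ι E : Type*} [DecidableEq ι] [NormedAddCommGroup E]
    [InnerProductSpace ℝ E] (A₁ A₂ B : E →ₗ[ℝ] E) (b : ι → E) (k : ι → ℕ) : Prop where
  linearIndependent : LinearIndependent ℝ b
  inner_B : ∀ i j, inner ℝ (b i) (B (b j)) = if i = j ∧ k i ≤ 1 then 1 else 0
  inner_A₁_ne : ∀ i j, i ≠ j → inner ℝ (b i) (A₁ (b j)) = 0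
  inner_A₁_pos : ∀ i, k i = 0 → 0 < inner ℝ (b i) (A₁ (b i))
  inner_A₁_zero : ∀ i, 1 ≤ k i → inner ℝ (b i) (A₁ (b i)) = 0
  inner_A₂_one_one : ∀ i j, k i = 1 → k j = 1 → i ≠ j → inner ℝ (b i) (A₂ (b j)) = 0
  inner_A₂_two_two : ∀ i j, k i = 2 → k j = 2 →
    inner ℝ (b i) (A₂ (b j)) = if i = j then -1 else 0
  exists_inner_A₂_ne : ∃ i j, k i = 0 ∧ 3 ≤ k j ∧ inner ℝ (b i) (A₂ (b j)) ≠ 0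
  inner_A₂_one_ge : ∀ i j, k i = 1 → 2 ≤ k j → inner ℝ (b i) (A₂ (b j)) = 0
  inner_A₂_two_three : ∀ i j, k i = 2 → 3 ≤ k j → inner ℝ (b i) (A₂ (b j)) = 0
  inner_A₂_three_three : ∀ i j, 3 ≤ k i → 3 ≤ k j → inner ℝ (b i) (A₂ (b j)) = 0

theorem IsAdaptedFamily.reindex {ι κ E : Type*} [DecidableEq ι] [DecidableEq κ]
    [NormedAddCommGroup E] [InnerProductSpace ℝ E] {A₁ A₂ B : E →ₗ[ℝ] E} {b : ι → E} {k : ι → ℕ}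
    (h : IsAdaptedFamily A₁ A₂ B b k) (e : κ ≃ ι) :
    IsAdaptedFamily A₁ A₂ B (b ∘ e) (k ∘ e) where
  linearIndependent := h.linearIndependent.comp e e.injective
  inner_B i j := by simp [h.inner_B]
  inner_A₁_ne i j hij := h.inner_A₁_ne _ _ (e.injective.ne hij)
  inner_A₁_pos i := h.inner_A₁_pos _
  inner_A₁_zero i := h.inner_A₁_zero _
  inner_A₂_one_one i j hi hj hij := h.inner_A₂_one_one _ _ hi hj (e.injective.ne hij)
  inner_A₂_two_two i j hi hj := by simpa using h.inner_A₂_two_two _ _ hi hj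
  exists_inner_A₂_ne := by
    obtain ⟨i, j, hi, hj, hij⟩ := h.exists_inner_A₂_ne
    exact ⟨e.symm i, e.symm j, by simpa using hi, by simpa using hj, by simpa using hij⟩
  inner_A₂_one_ge i j := h.inner_A₂_one_ge _ _
  inner_A₂_two_three i j := h.inner_A₂_two_three _ _
  inner_A₂_three_three i j := h.inner_A₂_three_three _ _

theorem eq_zero_of_forall_add_mul_nonneg {a c : ℝ} (h : ∀ t : ℝ, 0 ≤ a + t * c) : c = 0 := by
  by_contra hc
  have := h (-(a + 1) / c)
  rw [div_mul_cancel₀ _ hc] at this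
  linarith

section InnerProduct

variable {E : Type*} [NormedAddCommGroup E] [InnerProductSpace ℝ E]

theorem LinearMap.IsSymmetric.inner_map_eq_zero_of_nonneg_on {S : E →ₗ[ℝ] E} (hS : S.IsSymmetric)
    {N : Submodule ℝ E} (hN : ∀ x ∈ N, 0 ≤ inner ℝ x (S x)) {u w : E} (hu : u ∈ N)
    (hu0 : inner ℝ u (S u) = 0) (hw : w ∈ N) : inner ℝ w (S u) = 0 := by
  have key : ∀ t : ℝ, 0 ≤ inner ℝ w (S w) + t * (2 * inner ℝ w (S u)) := fun t => by
    have h := hN _ (N.add_mem hw (N.smul_mem t hu))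
    have hsym : inner ℝ u (S w) = inner ℝ w (S u) := by
      rw [← hS u w, real_inner_comm]
    simp only [map_add, map_smul, inner_add_left, inner_add_right, real_inner_smul_left,
      real_inner_smul_right, hu0, hsym] at h
    linarith
  linarith [eq_zero_of_forall_add_mul_nonneg key]

theorem LinearMap.IsSymmetric.map_eq_zero_of_nonneg {S : E →ₗ[ℝ] E} (hS : S.IsSymmetric)
    (hpos : ∀ x, 0 ≤ inner ℝ x (S x)) {u : E} (hu0 : inner ℝ u (S u) = 0) : S u = 0 :=
  inner_self_eq_zero.1 <| hS.inner_map_eq_zero_of_nonneg_on (N := ⊤) (fun x _ => hpos x)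
    Submodule.mem_top hu0 Submodule.mem_top

/-- A symmetric form pulled back along a linear map has an orthogonal basis that is orthonormal. -/
theorem LinearMap.IsSymmetric.exists_orthonormalBasis_pullback [FiniteDimensional ℝ E]
    {F : Type*} [NormedAddCommGroup F] [InnerProductSpace ℝ F] [FiniteDimensional ℝ F]
    {A : E →ₗ[ℝ] E} (hA : A.IsSymmetric) (L : F →ₗ[ℝ] E) :
    ∃ b : OrthonormalBasis (Fin (Module.finrank ℝ F)) ℝ F,
      ∀ i j, i ≠ j → inner ℝ (L (b i)) (A (L (b j))) = 0 := by
  have hG : (LinearMap.adjoint L ∘ₗ A ∘ₗ L).IsSymmetric := fun x y => by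
    simp only [LinearMap.comp_apply, LinearMap.adjoint_inner_left, LinearMap.adjoint_inner_right]
    exact hA _ _
  refine ⟨hG.eigenvectorBasis rfl, fun i j hij => ?_⟩
  have h := hG.apply_eigenvectorBasis rfl j
  rw [← LinearMap.adjoint_inner_right]
  change inner ℝ _ ((LinearMap.adjoint L ∘ₗ A ∘ₗ L) _) = 0
  rw [h, inner_smul_right, OrthonormalBasis.inner_eq_ite, if_neg hij, mul_zero]

/-- If `S` is nonnegative on the kernel of `A ≥ 0` but no `S + α A` is nonnegative, then some
vector of the kernel is `S`-isotropic without being in the kernel of `S`. -/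
theorem exists_isotropic_of_forall_not_nonneg [FiniteDimensional ℝ E] {S A : E →ₗ[ℝ] E}
    (hS : S.IsSymmetric) (hA : A.IsSymmetric) (hpos : ∀ x, 0 ≤ inner ℝ x (A x))
    (hker : ∀ x, A x = 0 → 0 ≤ inner ℝ x (S x))
    (hneg : ∀ α : ℝ, ∃ x, inner ℝ x (S x) + α * inner ℝ x (A x) < 0) :
    ∃ u, A u = 0 ∧ inner ℝ u (S u) = 0 ∧ S u ≠ 0 := by
  by_contra! hcon
  have hScont : Continuous S := S.continuous_of_finiteDimensional
  have hAcont : Continuous A := A.continuous_of_finiteDimensional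
  set Z := LinearMap.ker A ⊓ LinearMap.ker S
  have hC : IsCompact (Metric.sphere (0 : E) 1 ∩ (Zᗮ : Set E)) :=
    (isCompact_sphere 0 1).inter_right (Submodule.isClosed_orthogonal Z)
  obtain ⟨m, hm⟩ := hC.elim_directed_cover
    (fun m : ℕ => {u : E | 0 < inner ℝ u (S u) + m * inner ℝ u (A u)})
    (fun m => isOpen_lt (by fun_prop) (by fun_prop))
    (fun u hu => by
      simp only [Set.mem_iUnion, Set.mem_ofPred_eq]
      rcases (hpos u).eq_or_lt with h0 | h0
      · refine ⟨0, ?_⟩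
        have hAu := hA.map_eq_zero_of_nonneg hpos h0.symm
        refine lt_of_le_of_ne (by simpa using hker u hAu) fun h => ?_
        have hSu := hcon u hAu (by simpa using h.symm)
        have huZ : u ∈ Z := ⟨hAu, hSu⟩
        have : u = 0 := inner_self_eq_zero.1 (hu.2 u huZ)
        simpa [this] using hu.1
      · obtain ⟨m, hm⟩ := exists_nat_gt (-inner ℝ u (S u) / inner ℝ u (A u))
        refine ⟨m, ?_⟩
        rw [div_lt_iff₀ h0] at hm
        linarith)
    (Monotone.directed_le fun a b hab u hu => by
      simp only [Set.mem_ofPred_eq] at hu ⊢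
      have : (a : ℝ) ≤ b := by exact_mod_cast hab
      nlinarith [hpos u])
  obtain ⟨x, hx⟩ := hneg m
  obtain ⟨z, hz, y, hy, rfl⟩ := Z.exists_add_mem_mem_orthogonal x
  have hAz : A z = 0 := hz.1
  have hSz : S z = 0 := hz.2
  have hzA : inner ℝ z (A y) = 0 := by rw [← hA, hAz, inner_zero_left]
  have hzS : inner ℝ z (S y) = 0 := by rw [← hS, hSz, inner_zero_left]
  simp only [map_add, hAz, hSz, zero_add, inner_add_left, hzA, hzS] at hx
  have hy0 : y ≠ 0 := by
    rintro rfl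
    simp at hx
  have hyn : 0 < ‖y‖ := norm_pos_iff.2 hy0
  have := hm (a := ‖y‖⁻¹ • y) ⟨by simp [norm_smul, hyn.ne'], Zᗮ.smul_mem _ hy⟩
  simp only [Set.mem_ofPred_eq, map_smul, real_inner_smul_left, real_inner_smul_right] at this
  have h2 : 0 < ‖y‖⁻¹ * ‖y‖⁻¹ * (inner ℝ y (S y) + m * inner ℝ y (A y)) := by linarith
  have h3 : 0 < ‖y‖⁻¹ * ‖y‖⁻¹ := by positivity
  linarith [pos_of_mul_pos_right h2 h3.le]


/-- The hypotheses say that `B` is an orthogonal projection, `A₁ ≥ 0` vanishes on `ker B`, some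
`κ B - A₂` is nonnegative on `ker A₁`, and `A₂` has an isotropic vector in `ker B` outside
`ker A₂`. -/
theorem exists_isAdaptedFamily [FiniteDimensional ℝ E] {n : ℕ}
    (hn : Module.finrank ℝ E = n) {A₁ A₂ B : E →ₗ[ℝ] E} (hA₁ : A₁.IsSymmetric)
    (hA₂ : A₂.IsSymmetric) (hB : B.IsSymmetric)
    (hidem : ∀ x, B (B x) = B x) (hker : LinearMap.ker B ≤ LinearMap.ker A₁)
    (hpos : ∀ x, 0 ≤ inner ℝ x (A₁ x)) {κ : ℝ}
    (hκ : ∀ x, A₁ x = 0 → inner ℝ x (A₂ x) ≤ κ * inner ℝ x (B x))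
    {u : E} (hBu : B u = 0) (hu : inner ℝ u (A₂ u) = 0) (hA₂u : A₂ u ≠ 0) :
    ∃ (b : Fin n → E) (k : Fin n → ℕ), Monotone k ∧ IsAdaptedFamily A₁ A₂ B b k := by
  subst hn
  set N := LinearMap.ker A₁
  set K := LinearMap.ker B
  have hnull : ∀ x ∈ K, inner ℝ x (A₂ x) = 0 → ∀ w ∈ N, inner ℝ w (A₂ x) = 0 := by
    intro x hx hx0 w hw
    have hBx : B x = 0 := hx
    have hS : (κ • B - A₂).IsSymmetric := (hB.smul (by simp)).sub hA₂
    have := hS.inner_map_eq_zero_of_nonneg_on (N := N)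
      (fun y hy => by simpa [inner_sub_right, real_inner_smul_right] using hκ y hy)
      (hker hx) (by simp [hBx, hx0]) hw
    simpa [hBx] using this
  have hBfix : ∀ x ∈ Kᗮ, B x = x := by
    intro x hx
    have hK : x - B x ∈ K := by simp [K, hidem]
    have h1 : inner ℝ (x - B x) x = 0 := hx _ hK
    have h2 : inner ℝ (x - B x) (B x) = 0 := by rw [← hB]; simp [hidem]
    have h3 : inner ℝ (x - B x) (x - B x) = 0 := by rw [inner_sub_right, h1, h2, sub_zero]
    exact (sub_eq_zero.1 (inner_self_eq_zero.1 h3)).symm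
  obtain ⟨b1, hb1⟩ := hA₁.exists_orthonormalBasis_pullback Nᗮ.subtype
  obtain ⟨b3, hb3⟩ := hA₂.exists_orthonormalBasis_pullback K.subtype
  simp only [Submodule.subtype_apply] at hb1 hb3
  set g : Fin (Module.finrank ℝ K) → ℝ := fun j => inner ℝ (b3 j : E) (A₂ (b3 j)) with hg
  have hg_nonpos : ∀ j, g j ≤ 0 := fun j => by
    have := hκ (b3 j) (hker (b3 j).2)
    rwa [show B (b3 j) = 0 from (b3 j).2, inner_zero_right, mul_zero] at this
  set W := Kᗮ ⊓ N
  -- the correction makes the image of `W` orthogonal to `K` for the form `A₂`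
  let L : W →ₗ[ℝ] E := W.subtype -
    ∑ j, (g j)⁻¹ • ((innerₛₗ ℝ (A₂ (b3 j))).comp W.subtype).smulRight (b3 j : E)
  have hL : ∀ w : W, L w = w - ∑ j, ((g j)⁻¹ * inner ℝ (A₂ (b3 j)) (w : E)) • (b3 j : E) :=
    fun w => by simp [L, smul_smul]
  have hLK : ∀ w : W, L w - w ∈ K := fun w => by
    rw [hL, sub_sub_cancel_left]
    exact K.neg_mem (K.sum_mem fun j _ => K.smul_mem _ (b3 j).2)
  have hBL : ∀ w : W, B (L w) = w := fun w => by
    have : B (L w - w) = 0 := hLK w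
    rwa [map_sub, hBfix _ w.2.1, sub_eq_zero] at this
  have hA₁L : ∀ w : W, A₁ (L w) = 0 := fun w => by
    have h1 : A₁ (L w - w) = 0 := hker (hLK w)
    rwa [map_sub, show A₁ (w : E) = 0 from w.2.2, sub_zero] at h1
  have hLA₂ : ∀ (w : W) j, inner ℝ (L w) (A₂ (b3 j)) = 0 := fun w j => by
    rw [hL, inner_sub_left, sum_inner, Finset.sum_eq_single j]
    · rw [real_inner_smul_left, real_inner_comm (w : E)]
      by_cases hj : g j = 0
      · rw [hnull _ (b3 j).2 hj _ w.2.2]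
        ring
      · change _ - (g j)⁻¹ * _ * g j = 0
        rw [mul_right_comm, inv_mul_cancel₀ hj, one_mul, sub_self]
    · intro i _ hij
      rw [real_inner_smul_left, hb3 i j hij, mul_zero]
    · simp
  obtain ⟨b2, hb2⟩ := hA₂.exists_orthonormalBasis_pullback L
  set s : Fin (Module.finrank ℝ K) → ℝ := fun j => if g j = 0 then 1 else (√(-g j))⁻¹ with hs
  have hs0 : ∀ j, s j ≠ 0 := fun j => by
    by_cases hj : g j = 0
    · simp [hs, hj]
    · have : 0 < -g j := by have := lt_of_le_of_ne (hg_nonpos j) hj; linarith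
      simp [hs, hj, (Real.sqrt_pos.2 this).ne']
  have hs2 : ∀ j, g j ≠ 0 → s j * (s j * g j) = -1 := fun j hj => by
    have : 0 < -g j := by have := lt_of_le_of_ne (hg_nonpos j) hj; linarith
    have h1 := Real.mul_self_sqrt this.le
    have h2 := (Real.sqrt_pos.2 this).ne'
    simp only [hs, if_neg hj]
    field_simp
    nlinarith
  have h12 : ∀ i j, inner ℝ (b1 i : E) (b2 j : E) = 0 := fun i j =>
    (Submodule.mem_orthogonal' _ _).1 (b1 i).2 _ (b2 j).2.2
  have hBb1 : ∀ i, B (b1 i) = b1 i := fun i =>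
    hBfix _ (Submodule.orthogonal_le hker (b1 i).2)
  have hBb3 : ∀ i, B (b3 i) = 0 := fun i => (b3 i).2
  have hA₁b3 : ∀ i, A₁ (b3 i) = 0 := fun i => hker (b3 i).2
  have ho1 : ∀ i j, inner ℝ (b1 i : E) (b1 j : E) = if i = j then 1 else 0 := fun i j => by
    rw [← Submodule.coe_inner, OrthonormalBasis.inner_eq_ite]
  have ho2 : ∀ i j, inner ℝ (b2 i : E) (b2 j : E) = if i = j then 1 else 0 := fun i j => by
    rw [← Submodule.coe_inner, OrthonormalBasis.inner_eq_ite]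
  have ho3 : ∀ i j, inner ℝ (b3 i : E) (b3 j : E) = if i = j then 1 else 0 := fun i j => by
    rw [← Submodule.coe_inner, OrthonormalBasis.inner_eq_ite]
  let b : Fin (Module.finrank ℝ Nᗮ) ⊕ Fin (Module.finrank ℝ W) ⊕ Fin (Module.finrank ℝ K) → E :=
    Sum.elim (fun i => (b1 i : E)) (Sum.elim (fun i => L (b2 i)) fun i => s i • (b3 i : E))
  let k : Fin (Module.finrank ℝ Nᗮ) ⊕ Fin (Module.finrank ℝ W) ⊕ Fin (Module.finrank ℝ K) → ℕ :=
    Sum.elim (fun _ => 0) (Sum.elim (fun _ => 1) fun i => if g i = 0 then 3 else 2)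
  have hBB : ∀ x y, inner ℝ x (B y) = inner ℝ (B x) (B y) := fun x y => by rw [hB, hidem]
  have hfam : IsAdaptedFamily A₁ A₂ B b k := by
    constructor
    · rw [Fintype.linearIndependent_iff]
      intro c hc
      simp only [Fintype.sum_sum_type, b, Sum.elim_inl, Sum.elim_inr] at hc
      have hc1 : ∀ i, c (.inl i) = 0 := fun i => by
        have := congrArg (fun x => inner ℝ (b1 i : E) (B x)) hc
        simpa [inner_add_right, inner_sum, real_inner_smul_right, hBb1, hBL, hBb3, ho1, h12]
          using this
      have hc2 : ∀ i, c (.inr (.inl i)) = 0 := fun i => by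
        have := congrArg (fun x => inner ℝ (b2 i : E) (B x)) hc
        simpa [inner_add_right, inner_sum, real_inner_smul_right, hBb1, hBL, hBb3, ho2, hc1]
          using this
      have hc3 : ∀ i, c (.inr (.inr i)) = 0 := fun i => by
        have := congrArg (fun x => inner ℝ (b3 i : E) x) hc
        simpa [inner_add_right, inner_sum, real_inner_smul_right, ho3, hc1, hc2, hs0]
          using this
      rintro (i | i | i)
      exacts [hc1 i, hc2 i, hc3 i]
    · have h21 : ∀ i j, inner ℝ (b2 j : E) (b1 i : E) = 0 := fun i j => by
        rw [real_inner_comm, h12]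
      have hk3 : ∀ i, ¬ (if g i = 0 then 3 else 2) ≤ 1 := fun i => by split_ifs <;> simp
      intro i j
      rw [hBB]
      rcases i with i | i | i <;> rcases j with j | j | j <;>
        simp [b, k, hBb1, hBL, hBb3, ho1, ho2, h12, h21, hk3]
    · intro i j hij
      rcases i with i | i | i <;> rcases j with j | j | j <;>
        simp only [b, Sum.elim_inl, Sum.elim_inr, map_smul, hA₁L, hA₁b3, inner_zero_right,
          smul_zero] <;>
        try (rw [← hA₁]; simp only [map_smul, hA₁L, hA₁b3, inner_zero_left, smul_zero])
      exact hb1 i j (by simpa using hij)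
    · rintro (i | i | i) hi
      · refine lt_of_le_of_ne (hpos _) fun h => ?_
        have h1 : (b1 i : E) ∈ N := hA₁.map_eq_zero_of_nonneg hpos h.symm
        have h2 := (Submodule.mem_orthogonal' _ _).1 (b1 i).2 _ h1
        rw [ho1, if_pos rfl] at h2
        exact one_ne_zero h2
      · simp [k] at hi
      · simp only [k, Sum.elim_inr] at hi
        split_ifs at hi
    · rintro (i | i | i) hi
      · simp [k] at hi
      · simp [b, hA₁L]
      · simp [b, hA₁b3]
    · have hk3 : ∀ i, ¬ (if g i = 0 then 3 else 2) = 1 := fun i => by split_ifs <;> simp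
      rintro (i | i | i) (j | j | j) hi hj hij <;> simp [k, hk3] at hi hj
      exact hb2 i j (by simpa using hij)
    · rintro (i | i | i) (j | j | j) hi hj <;> simp [k] at hi hj
      rcases eq_or_ne i j with rfl | hij
      · simpa [b, real_inner_smul_left, real_inner_smul_right] using hs2 i hi
      · simp [b, real_inner_smul_left, real_inner_smul_right, hb3 i j hij, hij]
    · by_contra! hcon
      obtain ⟨c, hc⟩ : ∃ c : Fin (Module.finrank ℝ K) → ℝ, u = ∑ j, c j • (b3 j : E) :=
        ⟨fun j => inner ℝ (b3 j) ⟨u, hBu⟩,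
          by simpa using (congrArg Subtype.val (b3.sum_repr' ⟨u, hBu⟩)).symm⟩
      have hcg : ∀ j, c j ≠ 0 → g j = 0 := by
        have h0 : ∑ j, c j * (c j * g j) = 0 := by
          rw [← hu, hc, map_sum, sum_inner]
          refine Finset.sum_congr rfl fun j _ => ?_
          rw [inner_sum, Finset.sum_eq_single j]
          · rw [map_smul, real_inner_smul_left, real_inner_smul_right]
          · intro i _ hij
            rw [map_smul, real_inner_smul_left, real_inner_smul_right, hb3 j i hij.symm]
            simp
          · simp
        rw [Finset.sum_eq_zero_iff_of_nonpos fun j _ => by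
          nlinarith [hg_nonpos j, mul_self_nonneg (c j)]] at h0
        intro j hj
        simpa [hj] using h0 j (Finset.mem_univ j)
      have hmem : A₂ u ∈ Nᗮ := (Submodule.mem_orthogonal _ _).2 (hnull u hBu hu)
      have hperp : ∀ i, inner ℝ (b1 i : E) (A₂ u) = 0 := fun i => by
        rw [hc, map_sum, inner_sum]
        refine Finset.sum_eq_zero fun j _ => ?_
        rw [map_smul, real_inner_smul_right]
        by_cases hj : c j = 0
        · rw [hj, zero_mul]
        · have := hcon (.inl i) (.inr (.inr j)) rfl (by simp [k, hcg j hj])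
          rw [show b (.inr (.inr j)) = s j • (b3 j : E) from rfl, map_smul,
            real_inner_smul_right] at this
          rw [show inner ℝ (b1 i : E) (A₂ (b3 j)) = 0 from
            (mul_eq_zero.1 this).resolve_left (hs0 j), mul_zero]
      apply hA₂u
      have := congrArg Subtype.val (b1.sum_repr' ⟨A₂ u, hmem⟩)
      simpa [hperp] using this.symm
    · rintro (i | i | i) (j | j | j) hi hj <;> simp [k] at hi hj
      · simp [b, real_inner_smul_right, hLA₂]
      all_goals split_ifs at hi <;> omega
    · rintro (i | i | i) (j | j | j) hi hj <;> simp [k] at hi hj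
      have hij : i ≠ j := by
        rintro rfl
        simp [hi] at hj
      simp [b, real_inner_smul_left, real_inner_smul_right, hb3 i j hij]
    · have hk3 : ∀ i, 3 ≤ (if g i = 0 then 3 else 2) → g i = 0 := fun i h => by
        by_contra h'
        simp [h'] at h
      rintro (i | i | i) (j | j | j) hi hj <;> simp [k] at hi hj
      have := hnull _ (b3 j).2 (hk3 j hj) _ (hker (b3 i).2)
      simp [b, real_inner_smul_left, real_inner_smul_right, this]
  have hcard : Fintype.card (Fin (Module.finrank ℝ E)) = Fintype.card
      (Fin (Module.finrank ℝ Nᗮ) ⊕ Fin (Module.finrank ℝ W) ⊕ Fin (Module.finrank ℝ K)) := by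
    have h1 := Submodule.finrank_add_inf_finrank_orthogonal hker
    have h2 := N.finrank_add_finrank_orthogonal
    simp only [Fintype.card_sum, Fintype.card_fin, W]
    omega
  let e := Fintype.equivOfCardEq hcard
  exact ⟨_, _, Tuple.monotone_sort (k ∘ e), (hfam.reindex e).reindex (Tuple.sort (k ∘ e))⟩

end InnerProduct

section Matrix

variable {n : ℕ}

theorem inner_toEuclideanLin (A : Matrix (Fin n) (Fin n) ℝ) (x y : EuclideanSpace ℝ (Fin n)) :
    inner ℝ x (Matrix.toEuclideanLin A y) = x.ofLp ⬝ᵥ A *ᵥ y.ofLp := by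
  rw [EuclideanSpace.inner_eq_star_dotProduct, dotProduct_comm]
  simp

theorem Matrix.IsSymm.isSymmetric_toEuclideanLin {A : Matrix (Fin n) (Fin n) ℝ} (hA : A.IsSymm) :
    (Matrix.toEuclideanLin A).IsSymmetric := fun x y => by
  rw [inner_toEuclideanLin, real_inner_comm, inner_toEuclideanLin, dotProduct_mulVec,
    ← mulVec_transpose, hA.eq, dotProduct_comm]

theorem exists_standardFormSys_of_isAdaptedFamily {A1 A2 B : Matrix (Fin n) (Fin n) ℝ}
    (hA1 : A1.IsSymm) (hA2 : A2.IsSymm) {b : Fin n → EuclideanSpace ℝ (Fin n)} {k : Fin n → ℕ}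
    (hk : Monotone k) (h : IsAdaptedFamily (Matrix.toEuclideanLin A1) (Matrix.toEuclideanLin A2)
      (Matrix.toEuclideanLin B) b k) :
    ∃ T : Matrix (Fin n) (Fin n) ℝ, IsUnit T ∧
      StandardFormSys (Tᵀ * A1 * T) (Tᵀ * A2 * T) (Tᵀ * B * T) := by
  set T : Matrix (Fin n) (Fin n) ℝ := .of fun a i => b i a with hT
  have hentry : ∀ (A : Matrix (Fin n) (Fin n) ℝ) i j,
      (Tᵀ * A * T) i j = inner ℝ (b i) (Matrix.toEuclideanLin A (b j)) := fun A i j => by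
    rw [inner_toEuclideanLin, Matrix.mul_assoc, Matrix.mul_apply']
    rfl
  have hsymm : ∀ A : Matrix (Fin n) (Fin n) ℝ, A.IsSymm → (Tᵀ * A * T).IsSymm := fun A hA => by
    simp [Matrix.IsSymm, Matrix.transpose_mul, hA.eq, Matrix.mul_assoc]
  obtain ⟨card, hcard, hle, hpos⟩ : ∃ card : ℕ → ℕ,
      (∀ m (a : Fin n), a.val < card m ↔ k a ≤ m) ∧ (∀ m m', m ≤ m' → card m ≤ card m') ∧
      ∀ m a, k a ≤ m → 0 < card m :=
    ⟨fun m => (Finset.univ.filter fun i => k i ≤ m).card,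
      fun m a => Tuple.lt_card_le_iff_apply_le_of_monotone hk,
      fun m m' hm => Finset.card_le_card
        (Finset.monotone_filter_right _ fun i _ hi => le_trans hi hm),
      fun m a ha => Finset.card_pos.2 ⟨a, by simpa using ha⟩⟩
  have hcard' : ∀ m (a : Fin n), card m ≤ a.val ↔ m < k a := fun m a => by
    rw [← not_lt, hcard, not_le]
  obtain ⟨i₀, j₀, hi₀, hj₀, hij₀⟩ := h.exists_inner_A₂_ne
  have h01 := hle 0 1 zero_le_one
  have h12 := hle 1 2 one_le_two
  have h2n : card 2 < n := ((hcard' 2 j₀).2 (by omega)).trans_lt j₀.isLt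
  have hs : card 1 + (card 2 - card 1) = card 2 := by omega
  refine ⟨T, ?_, hsymm _ hA1, hsymm _ hA2, card 0, card 1, card 2 - card 1,
    hpos 0 i₀ hi₀.le, h01, by omega, by omega, ?_⟩
  · rw [← Matrix.linearIndependent_cols_iff_isUnit]
    exact h.linearIndependent.map' (WithLp.linearEquiv 2 ℝ (Fin n → ℝ)).toLinearMap
      (LinearEquiv.ker _)
  rw [hs]
  simp only [hentry, hcard, hcard']
  exact ⟨h.inner_B, h.inner_A₁_ne, fun a ha => h.inner_A₁_pos a (by omega),
    fun a ha => h.inner_A₁_zero a (by omega),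
    fun i j h1 h2 h3 h4 => h.inner_A₂_one_one i j (by omega) (by omega),
    fun i j h1 h2 h3 h4 => h.inner_A₂_two_two i j (by omega) (by omega),
    ⟨i₀, j₀, by omega, by omega, hij₀⟩,
    fun i j h1 h2 h3 => h.inner_A₂_one_ge i j (by omega) (by omega),
    fun i j h1 h2 h3 => h.inner_A₂_two_three i j (by omega) (by omega),
    fun i j h1 h2 => h.inner_A₂_three_three i j (by omega) (by omega)⟩

end Matrix

theorem Convex.exists_ne_zero_forall_le {V : Type*} [NormedAddCommGroup V] [NormedSpace ℝ V]
    [FiniteDimensional ℝ V] {K : Set V} (hK : Convex ℝ K) (h0 : 0 ∈ K) {x : V} (hx : x ∉ K) :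
    ∃ f : V →ₗ[ℝ] ℝ, f ≠ 0 ∧ ∀ a ∈ K, f a ≤ f x := by
  by_cases hint : (interior K).Nonempty
  · obtain ⟨f, hf, hfK⟩ := geometric_hahn_banach_of_nonempty_interior_point hK
      (fun h => hx (interior_subset h)) hint
    exact ⟨f, fun h => hf (ContinuousLinearMap.coe_injective h), hfK⟩
  · have hspan : Submodule.span ℝ K < ⊤ := by
      refine lt_top_iff_ne_top.2 fun h => hint ?_
      rw [hK.interior_nonempty_iff_affineSpan_eq_top, ← Set.insert_eq_of_mem h0]
      refine SetLike.coe_injective ?_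
      rw [affineSpan_insert_zero, h]
      rfl
    obtain ⟨f, hf, hfK⟩ := Submodule.exists_le_ker_of_lt_top _ hspan
    have hzero : ∀ a ∈ K, f a = 0 := fun a ha => hfK (Submodule.subset_span ha)
    rcases le_total 0 (f x) with h | h
    · exact ⟨f, hf, fun a ha => by rw [hzero a ha]; exact h⟩
    · exact ⟨-f, neg_ne_zero.2 hf, fun a ha => by simpa [hzero a ha] using h⟩

theorem Matrix.trace_mul_vecMulVec_self {n : ℕ} (A : Matrix (Fin n) (Fin n) ℝ) (v : Fin n → ℝ) :
    (A * vecMulVec v v).trace = v ⬝ᵥ A *ᵥ v := by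
  rw [mul_vecMulVec, trace_vecMulVec, dotProduct_comm]

theorem Matrix.posSemidef_vecMulVec_self {n : ℕ} (v : Fin n → ℝ) : (vecMulVec v v).PosSemidef := by
  simpa using posSemidef_vecMulVec_self_star v

theorem Matrix.IsSymm.posSemidef_iff {n : ℕ} {A : Matrix (Fin n) (Fin n) ℝ} (hA : A.IsSymm) :
    A.PosSemidef ↔ ∀ v, 0 ≤ v ⬝ᵥ A *ᵥ v :=
  ⟨fun h v => by simpa using h.dotProduct_mulVec_nonneg v, fun h =>
    .of_dotProduct_mulVec_nonneg (by simpa [IsHermitian, conjTranspose_eq_transpose_of_trivial]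
      using hA.eq) (by simpa using h)⟩

/-- If every dual feasible point has value larger than `t`, then some nonzero functional separates
`(c, t)` from the cone of right-hand sides for which the dual is feasible with bounded value. -/
theorem exists_posSemidef_add_smul_of_forall_lt_trace {n m : ℕ}
    {A : Fin m → Matrix (Fin n) (Fin n) ℝ} {B : Matrix (Fin n) (Fin n) ℝ}
    (hA : ∀ i, (A i).IsSymm) (hB : B.IsSymm) {c : Fin m → ℝ} {t : ℝ}
    (h : ∀ Y : Matrix (Fin n) (Fin n) ℝ, Y.PosSemidef → (∀ i, (A i * Y).trace = c i) →
      t < (B * Y).trace) :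
    ∃ (x : Fin m → ℝ) (x₀ : ℝ), (x ≠ 0 ∨ x₀ ≠ 0) ∧ 0 ≤ x₀ ∧
      (∑ i, x i • A i + x₀ • B).PosSemidef ∧ ∑ i, c i * x i + x₀ * t ≤ 0 := by
  set K : Set ((Fin m → ℝ) × ℝ) := {z | ∃ Y : Matrix (Fin n) (Fin n) ℝ, Y.PosSemidef ∧
    (∀ i, (A i * Y).trace = z.1 i) ∧ (B * Y).trace ≤ z.2}
  have hsmul : ∀ s : ℝ, 0 ≤ s → ∀ z ∈ K, s • z ∈ K := by
    rintro s hs z ⟨Y, hY, h1, h2⟩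
    exact ⟨s • Y, hY.smul hs, fun i => by simp [h1], by
      simpa using mul_le_mul_of_nonneg_left h2 hs⟩
  have hadd : ∀ z ∈ K, ∀ w ∈ K, z + w ∈ K := by
    rintro z ⟨Y, hY, h1, h2⟩ w ⟨Z, hZ, h3, h4⟩
    exact ⟨Y + Z, hY.add hZ, fun i => by simp [mul_add, h1, h3], by
      simpa [mul_add] using add_le_add h2 h4⟩
  have hK : Convex ℝ K := fun z hz w hw a b ha hb _ =>
    hadd _ (hsmul a ha z hz) _ (hsmul b hb w hw)
  have h0 : (0 : (Fin m → ℝ) × ℝ) ∈ K := ⟨0, .zero, by simp, by simp⟩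
  have hc : (c, t) ∉ K := fun ⟨Y, hY, h1, h2⟩ => (h Y hY h1).not_ge h2
  obtain ⟨f, hf, hfK⟩ := hK.exists_ne_zero_forall_le h0 hc
  have hfK0 : ∀ z ∈ K, f z ≤ 0 := fun z hz => by
    by_contra! hpos
    have h1 := hfK _ (hsmul ((|f (c, t)| + 1) / f z) (by positivity) z hz)
    rw [map_smul, smul_eq_mul, div_mul_cancel₀ _ hpos.ne'] at h1
    linarith [le_abs_self (f (c, t))]
  have hfct : 0 ≤ f (c, t) := by simpa using hfK 0 h0
  have hfeq : ∀ z w, f (z, w) =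
      -(∑ i, z i * -f (Pi.single i 1, 0) + w * -f (0, 1)) := fun z w => by
    have hz : (z, w) = ∑ i, z i • ((Pi.single i 1 : Fin m → ℝ), (0 : ℝ)) +
        w • ((0 : Fin m → ℝ), (1 : ℝ)) := by
      ext j
      · simp [Prod.fst_sum, Finset.sum_apply, Pi.single_apply]
      · simp [Prod.snd_sum]
    conv_lhs => rw [hz]
    simp only [map_add, map_sum, map_smul, smul_eq_mul, mul_neg, Finset.sum_neg_distrib]
    ring
  refine ⟨fun i => -f (Pi.single i 1, 0), -f (0, 1), ?_, ?_, ?_, ?_⟩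
  · by_contra! hne
    obtain ⟨h1, h2⟩ := hne
    refine hf (LinearMap.ext fun z => ?_)
    have h1' : ∀ i, -f (Pi.single i 1, 0) = 0 := fun i => congrFun h1 i
    rw [← Prod.mk.eta (p := z), hfeq]
    simp [h1', h2]
  · have := hfK0 (0, 1) ⟨0, .zero, by simp, by simp⟩
    linarith
  · have hsymm : (∑ i, -f (Pi.single i 1, 0) • A i + -f (0, 1) • B).IsSymm := by
      simp [IsSymm, transpose_sum, (hA _).eq, hB.eq]
    rw [hsymm.posSemidef_iff]
    intro v
    have := hfK0 (fun i => v ⬝ᵥ A i *ᵥ v, v ⬝ᵥ B *ᵥ v) ⟨vecMulVec v v,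
      posSemidef_vecMulVec_self v, fun i => trace_mul_vecMulVec_self _ _,
      (trace_mul_vecMulVec_self _ _).le⟩
    rw [hfeq] at this
    simp only [add_mulVec, sum_mulVec, smul_mulVec, dotProduct_add, dotProduct_sum,
      dotProduct_smul, smul_eq_mul]
    simp only [mul_comm (_ ⬝ᵥ _)] at this
    linarith
  · rw [hfeq] at hfct
    linarith

theorem Matrix.PosSemidef.apply_eq_zero_of_diag_eq_zero {n : ℕ} {A : Matrix (Fin n) (Fin n) ℝ}
    (hA : A.PosSemidef) {j : Fin n} (hj : A j j = 0) (i : Fin n) : A i j = 0 := by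
  have h := (hA.dotProduct_mulVec_zero_iff (Pi.single j 1)).1 (by simpa using hj)
  simpa using congrFun h i

theorem StandardFormSys.eq_zero_of_posSemidef {n : ℕ} {A1 A2 B : Matrix (Fin n) (Fin n) ℝ}
    (h : StandardFormSys A1 A2 B) {x y : ℝ} (hxy : (B - (x • A1 + y • A2)).PosSemidef) : y = 0 := by
  obtain ⟨-, -, p, r', s, -, hpr, -, -, hB, hA1, -, hA1z, -, -, ⟨a, b, ha, hb, hab⟩, -, -,
    hlast⟩ := h
  have hne : a ≠ b := fun h => by subst h; omega
  have hbr : ¬ b.val < r' := by omega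
  have hdiag : (B - (x • A1 + y • A2)) b b = 0 := by
    simp [hB, hbr, hA1z b (by omega), hlast b b hb hb]
  simpa [hB, hne, hA1 a b hne, hab] using hxy.apply_eq_zero_of_diag_eq_zero hdiag a

theorem StandardFormSys.exists_pos_le_trace {n : ℕ} {A1 A2 B : Matrix (Fin n) (Fin n) ℝ}
    (h : StandardFormSys A1 A2 B) :
    ∃ δ : ℝ, 0 < δ ∧ ∀ Y : Matrix (Fin n) (Fin n) ℝ, Y.PosSemidef → (A1 * Y).trace = 0 →
      (A2 * Y).trace = 1 → δ ≤ (B * Y).trace := by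
  obtain ⟨-, hA2, p, r', s, -, hpr, -, -, hB, hA1, hA1p, hA1z, h11, h22, -, h1, h23, h33⟩ := h
  set M : ℝ := 1 + ∑ a, |A2 a a|
  have hMpos : 0 < M := by positivity
  have hMle : ∀ a, A2 a a ≤ M := fun a => by
    have := Finset.single_le_sum (fun i _ => abs_nonneg (A2 i i)) (Finset.mem_univ a)
    linarith [le_abs_self (A2 a a)]
  refine ⟨1 / M, by positivity, fun Y hY hY1 hY2 => ?_⟩
  have htrace : ∀ A : Matrix (Fin n) (Fin n) ℝ, (∀ a b, a ≠ b → A a b * Y b a = 0) →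
      (A * Y).trace = ∑ a, A a a * Y a a := fun A hAY => by
    simp only [trace, diag_apply, mul_apply]
    exact Finset.sum_congr rfl fun a _ => Finset.sum_eq_single a
      (fun b _ hb => hAY a b hb.symm) (by simp)
  rw [htrace A1 fun a b hab => by rw [hA1 a b hab, zero_mul]] at hY1
  have hA1nn : ∀ a, 0 ≤ A1 a a := fun a => by
    rcases lt_or_ge a.val p with ha | ha
    · exact (hA1p a ha).le
    · exact (hA1z a ha).ge
  rw [Finset.sum_eq_zero_iff_of_nonneg fun a _ => mul_nonneg (hA1nn a) hY.diag_nonneg] at hY1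
  have hYp : ∀ a, a.val < p → Y a a = 0 := fun a ha =>
    (mul_eq_zero.1 (hY1 a (Finset.mem_univ a))).resolve_left (hA1p a ha).ne'
  have hcol : ∀ a b, b.val < p → Y a b = 0 := fun a b hb =>
    hY.apply_eq_zero_of_diag_eq_zero (hYp b hb) a
  have hrow : ∀ a b, a.val < p → Y a b = 0 := fun a b ha => by
    rw [← hY.isHermitian.apply]
    simp [hcol b a ha]
  have hzero : ∀ a b, a ≠ b → p ≤ a.val → p ≤ b.val → a.val ≤ b.val → A2 a b = 0 :=
    fun a b hab ha hb hle => by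
      rcases lt_or_ge a.val r' with ha1 | ha1
      · rcases lt_or_ge b.val r' with hb1 | hb1
        · exact h11 a b ha ha1 hb hb1 hab
        · exact h1 a b ha ha1 hb1
      rcases lt_or_ge a.val (r' + s) with ha2 | ha2
      · rcases lt_or_ge b.val (r' + s) with hb2 | hb2
        · rw [h22 a b ha1 ha2 (by omega) hb2, if_neg hab]
        · exact h23 a b ha1 ha2 hb2
      · exact h33 a b ha2 (by omega)
  have hA2Y : ∀ a b, a ≠ b → A2 a b * Y b a = 0 := fun a b hab => by
    rcases lt_or_ge a.val p with ha | ha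
    · rw [hcol b a ha, mul_zero]
    rcases lt_or_ge b.val p with hb | hb
    · rw [hrow b a hb, mul_zero]
    rcases le_total a.val b.val with hle | hle
    · rw [hzero a b hab ha hb hle, zero_mul]
    · rw [← hA2.apply, hzero b a hab.symm hb ha hle, zero_mul]
  rw [htrace A2 hA2Y] at hY2
  rw [htrace B fun a b hab => by simp [hB, hab], div_le_iff₀ hMpos, ← hY2, Finset.sum_mul]
  refine Finset.sum_le_sum fun a _ => ?_
  rcases lt_or_ge a.val r' with ha | ha
  · simp only [hB, ha, and_self, if_true, one_mul]
    rw [mul_comm (Y a a)]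
    exact mul_le_mul_of_nonneg_right (hMle a) hY.diag_nonneg
  · have hA2aa : A2 a a ≤ 0 := by
      rcases lt_or_ge a.val (r' + s) with ha2 | ha2
      · simp [h22 a a ha ha2 ha ha2]
      · exact (h33 a a ha2 ha2).le
    simpa [hB, ha.not_gt] using mul_nonpos_of_nonpos_of_nonneg hA2aa hY.diag_nonneg

theorem exists_valP_lt_valD_of_standardFormSys {n : ℕ} {A1 A2 B T : Matrix (Fin n) (Fin n) ℝ}
    {V : Matrix (Fin 2) (Fin 2) ℝ} {μ : Fin 2 → ℝ} (hT : IsUnit T) (hV : IsUnit V)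
    (h : StandardFormSys (Tᵀ * (V 0 0 • A1 + V 0 1 • A2) * T)
      (Tᵀ * (V 1 0 • A1 + V 1 1 • A2) * T) (Tᵀ * (B + μ 0 • A1 + μ 1 • A2) * T)) :
    ∃ c : Fin 2 → ℝ, valP ![A1, A2] B c < valD ![A1, A2] B c := by
  obtain ⟨c, hc⟩ := mulVec_surjective_iff_isUnit.2 hV ![0, 1]
  have hc0 : V 0 0 * c 0 + V 0 1 * c 1 = 0 := by
    simpa [mulVec, dotProduct, Fin.sum_univ_two] using congrFun hc 0
  have hc1 : V 1 0 * c 0 + V 1 1 * c 1 = 1 := by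
    simpa [mulVec, dotProduct, Fin.sum_univ_two] using congrFun hc 1
  obtain ⟨δ, hδ, hle⟩ := h.exists_pos_le_trace
  have hP : valP ![A1, A2] B c ≤ ((-(c 0 * μ 0 + c 1 * μ 1) : ℝ) : EReal) := by
    refine sSup_le ?_
    rintro _ ⟨x, hx, rfl⟩
    simp only [EReal.coe_le_coe_iff, Fin.sum_univ_two]
    obtain ⟨y, hy⟩ := vecMul_surjective_iff_isUnit.2 hV (x + μ)
    have hy0 : y 0 * V 0 0 + y 1 * V 1 0 = x 0 + μ 0 := by
      simpa [vecMul, dotProduct, Fin.sum_univ_two] using congrFun hy 0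
    have hy1 : y 0 * V 0 1 + y 1 * V 1 1 = x 1 + μ 1 := by
      simpa [vecMul, dotProduct, Fin.sum_univ_two] using congrFun hy 1
    have hslack : B - ∑ i, x i • ![A1, A2] i = (B + μ 0 • A1 + μ 1 • A2) -
        (y 0 • (V 0 0 • A1 + V 0 1 • A2) + y 1 • (V 1 0 • A1 + V 1 1 • A2)) := by
      have e0 : x 0 = y 0 * V 0 0 + y 1 * V 1 0 - μ 0 := by linarith
      have e1 : x 1 = y 0 * V 0 1 + y 1 * V 1 1 - μ 1 := by linarith
      simp only [Fin.sum_univ_two, cons_val_zero, cons_val_one, e0, e1]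
      module
    have hpsd := (Set.mem_ofPred.1 hx).conjTranspose_mul_mul_same T
    rw [hslack, conjTranspose_eq_transpose_of_trivial] at hpsd
    simp only [Matrix.mul_sub, Matrix.sub_mul, Matrix.mul_add Tᵀ (y 0 • _), Matrix.mul_smul,
      Matrix.add_mul (y 0 • _), Matrix.smul_mul] at hpsd
    have hy10 := h.eq_zero_of_posSemidef hpsd
    have : c 0 * (x 0 + μ 0) + c 1 * (x 1 + μ 1) = 0 := by
      rw [← hy0, ← hy1]
      linear_combination y 0 * hc0 + y 1 * hc1 + hy10
    linarith
  have hD : ((-(c 0 * μ 0 + c 1 * μ 1) + δ : ℝ) : EReal) ≤ valD ![A1, A2] B c := by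
    refine le_sInf ?_
    rintro _ ⟨Y, ⟨hY, hYc⟩, rfl⟩
    rw [EReal.coe_le_coe_iff]
    have hY1 : (A1 * Y).trace = c 0 := hYc 0
    have hY2 : (A2 * Y).trace = c 1 := hYc 1
    have hTT : T * T⁻¹ = 1 := mul_nonsing_inv _ ((isUnit_iff_isUnit_det _).1 hT)
    have hTT' : T⁻¹ᵀ * Tᵀ = 1 := by rw [← transpose_mul, hTT, transpose_one]
    have htr : ∀ A : Matrix (Fin n) (Fin n) ℝ,
        (Tᵀ * A * T * (T⁻¹ * Y * T⁻¹ᵀ)).trace = (A * Y).trace := fun A => by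
      have : Tᵀ * A * T * (T⁻¹ * Y * T⁻¹ᵀ) = Tᵀ * (A * (T * T⁻¹) * Y * T⁻¹ᵀ) := by
        simp only [Matrix.mul_assoc]
      rw [this, trace_mul_comm, hTT, Matrix.mul_one, Matrix.mul_assoc, hTT', Matrix.mul_one]
    have := hle (T⁻¹ * Y * T⁻¹ᵀ) (by simpa using hY.mul_mul_conjTranspose_same T⁻¹)
      (by simpa [htr, Matrix.add_mul, hY1, hY2] using hc0)
      (by simpa [htr, Matrix.add_mul, hY1, hY2] using hc1)
    simp only [htr, Matrix.add_mul, trace_add, Matrix.smul_mul, trace_smul, hY1, hY2,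
      smul_eq_mul] at this
    linarith
  exact ⟨c, hP.trans_lt ((EReal.coe_lt_coe_iff.2 (by linarith)).trans_le hD)⟩

theorem exists_standardFormSys_of_forall_not_posSemidef {n : ℕ}
    {A1 A2 B : Matrix (Fin n) (Fin n) ℝ} (hA1 : A1.PosSemidef) (hA2 : A2.IsSymm)
    (hB : B.PosSemidef) (hBB : B * B = B) (hker : ∀ v, B *ᵥ v = 0 → A1 *ᵥ v = 0) {κ β : ℝ}
    (hβ : 0 < β) (hβκ : β * κ < 1)
    (hκ : ∀ v, A1 *ᵥ v = 0 → v ⬝ᵥ A2 *ᵥ v ≤ κ * (v ⬝ᵥ B *ᵥ v))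
    (hnot : ∀ α : ℝ, ¬ (B - β • A2 + α • A1).PosSemidef) :
    ∃ T : Matrix (Fin n) (Fin n) ℝ, IsUnit T ∧
      StandardFormSys (Tᵀ * A1 * T) (Tᵀ * A2 * T) (Tᵀ * B * T) := by
  have hA1s : A1.IsSymm := by simpa using hA1.isHermitian
  have hBs : B.IsSymm := by simpa using hB.isHermitian
  have hSs : (B - β • A2).IsSymm := hBs.sub (hA2.smul β)
  have hzero : ∀ (A : Matrix (Fin n) (Fin n) ℝ) x,
      Matrix.toEuclideanLin A x = 0 ↔ A *ᵥ x.ofLp = 0 := fun A x => by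
    rw [← (WithLp.linearEquiv 2 ℝ (Fin n → ℝ)).map_eq_zero_iff]
    rfl
  have hpos : ∀ x, 0 ≤ inner ℝ x (Matrix.toEuclideanLin A1 x) := fun x => by
    rw [inner_toEuclideanLin]
    exact hA1s.posSemidef_iff.1 hA1 _
  obtain ⟨u, hA1u, huS, hSu⟩ := exists_isotropic_of_forall_not_nonneg
    hSs.isSymmetric_toEuclideanLin hA1s.isSymmetric_toEuclideanLin hpos
    (fun x hx => by
      have h1 := hκ _ ((hzero _ _).1 hx)
      have h2 := hBs.posSemidef_iff.1 hB x.ofLp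
      rw [inner_toEuclideanLin]
      simp only [sub_mulVec, smul_mulVec, dotProduct_sub, dotProduct_smul, smul_eq_mul]
      nlinarith)
    (fun α => by
      by_contra! h
      refine hnot α ((hSs.add (hA1s.smul α)).posSemidef_iff.2 fun v => ?_)
      have := h (WithLp.toLp 2 v)
      simpa only [inner_toEuclideanLin, add_mulVec, smul_mulVec, dotProduct_add,
        dotProduct_smul, smul_eq_mul] using this)
  rw [inner_toEuclideanLin] at huS
  simp only [sub_mulVec, smul_mulVec, dotProduct_sub, dotProduct_smul, smul_eq_mul] at huS
  have huB : u.ofLp ⬝ᵥ B *ᵥ u.ofLp = 0 := by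
    have h1 := hκ _ ((hzero _ _).1 hA1u)
    have h2 := hBs.posSemidef_iff.1 hB u.ofLp
    nlinarith
  have huA2 : u.ofLp ⬝ᵥ A2 *ᵥ u.ofLp = 0 := by
    rw [huB, zero_sub, neg_eq_zero] at huS
    exact (mul_eq_zero.1 huS).resolve_left hβ.ne'
  have hBu : B *ᵥ u.ofLp = 0 := (hB.dotProduct_mulVec_zero_iff _).1 (by simpa using huB)
  obtain ⟨b, k, hk, hbk⟩ := exists_isAdaptedFamily (finrank_euclideanSpace_fin (𝕜 := ℝ) (n := n))
    hA1s.isSymmetric_toEuclideanLin hA2.isSymmetric_toEuclideanLin hBs.isSymmetric_toEuclideanLin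
    (fun x => by
      ext i
      have := congrArg (· *ᵥ x.ofLp) hBB
      simpa [← mulVec_mulVec] using congrFun this i)
    (fun x hx => (hzero _ _).2 (hker _ ((hzero _ _).1 hx))) hpos (κ := κ)
    (fun x hx => by
      simpa only [inner_toEuclideanLin] using hκ _ ((hzero _ _).1 hx))
    ((hzero _ _).2 hBu) (by rwa [inner_toEuclideanLin]) (fun h => hSu <| by
      rw [hzero] at h ⊢
      simp [sub_mulVec, smul_mulVec, hBu, h])
  exact exists_standardFormSys_of_isAdaptedFamily hA1s hA2 hk hbk

theorem exists_ne_zero_posSemidef_of_valP_lt_valD {n m : ℕ}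
    {A : Fin m → Matrix (Fin n) (Fin n) ℝ} {B : Matrix (Fin n) (Fin n) ℝ}
    (hA : ∀ i, (A i).IsSymm) (hB : B.PosSemidef) {c : Fin m → ℝ} (hgap : valP A B c < valD A B c) :
    ∃ x : Fin m → ℝ, x ≠ 0 ∧ (∑ i, x i • A i).PosSemidef ∧ ∑ i, c i * x i = 0 := by
  obtain ⟨t, hPt, htD⟩ := EReal.lt_iff_exists_real_btwn.1 hgap
  have hP : ∀ x : Fin m → ℝ, (B - ∑ i, x i • A i).PosSemidef → ∑ i, c i * x i < t := fun x hx =>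
    EReal.coe_lt_coe_iff.1 ((le_sSup ⟨x, hx, rfl⟩ : _ ≤ valP A B c).trans_lt hPt)
  obtain ⟨x, x₀, hne, hx₀, hpsd, hle⟩ := exists_posSemidef_add_smul_of_forall_lt_trace hA
    (by simpa using hB.isHermitian) (c := c) (t := t) fun Y hY hYc =>
      EReal.coe_lt_coe_iff.1 (htD.trans_le (sInf_le ⟨Y, ⟨hY, hYc⟩, rfl⟩ : valD A B c ≤ _))
  have hscale : ∀ τ : ℝ, (B + τ • ∑ i, x i • A i).PosSemidef → -τ * ∑ i, c i * x i < t :=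
    fun τ h => by
      have := hP (fun i => -τ * x i) (by
        simpa [mul_smul, ← Finset.smul_sum, Finset.sum_neg_distrib] using h)
      rw [Finset.mul_sum]
      simpa only [mul_left_comm] using this
  have hx₀0 : x₀ = 0 := by
    by_contra h0
    have hx₀pos : 0 < x₀ := lt_of_le_of_ne hx₀ (Ne.symm h0)
    have h1 := hscale x₀⁻¹ (by
      have := hpsd.smul (inv_nonneg.2 hx₀)
      rwa [smul_add, smul_smul, inv_mul_cancel₀ h0, one_smul, add_comm] at this)
    have h2 := mul_lt_mul_of_pos_left h1 hx₀pos
    rw [neg_mul, mul_neg, mul_inv_cancel_left₀ h0] at h2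
    linarith
  subst hx₀0
  simp only [zero_smul, add_zero, zero_mul, ne_eq, not_true_eq_false, or_false] at hne hpsd hle
  refine ⟨x, hne, hpsd, le_antisymm hle ?_⟩
  by_contra! hlt
  have h1 := hscale (|t| / -∑ i, c i * x i)
    (hB.add (hpsd.smul (div_nonneg (abs_nonneg t) (by linarith))))
  rw [div_neg, neg_neg, div_mul_cancel₀ _ hlt.ne] at h1
  linarith [le_abs_self t]

theorem Matrix.PosSemidef.mulVec_eq_zero_of_rank_add_le {n : ℕ}
    {A B : Matrix (Fin n) (Fin n) ℝ} (hA : A.PosSemidef) (hB : B.PosSemidef)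
    (hrank : (B + A).rank ≤ B.rank) {v : Fin n → ℝ} (hv : B *ᵥ v = 0) : A *ᵥ v = 0 := by
  have hle : LinearMap.ker (B + A).mulVecLin ≤ LinearMap.ker B.mulVecLin := fun w hw => by
    have h1 : (B + A) *ᵥ w = 0 := hw
    have h2 : w ⬝ᵥ B *ᵥ w + w ⬝ᵥ A *ᵥ w = 0 := by
      rw [← dotProduct_add, ← add_mulVec, h1, dotProduct_zero]
    have h3 := hA.dotProduct_mulVec_nonneg w
    have h4 := hB.dotProduct_mulVec_nonneg w
    rw [star_trivial] at h3 h4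
    exact (hB.dotProduct_mulVec_zero_iff w).1 (by rw [star_trivial]; linarith)
  have heq := Submodule.eq_of_le_of_finrank_le hle <| by
    have h1 := (B + A).mulVecLin.finrank_range_add_finrank_ker
    have h2 := B.mulVecLin.finrank_range_add_finrank_ker
    change (B + A).rank + _ = _ at h1
    change B.rank + _ = _ at h2
    omega
  have hmem : v ∈ LinearMap.ker (B + A).mulVecLin := heq ▸ hv
  have h1 : (B + A) *ᵥ v = 0 := hmem
  rwa [add_mulVec, hv, zero_add] at h1

theorem exists_standardFormSys_of_valP_lt_valD {n : ℕ} {A1 A2 B : Matrix (Fin n) (Fin n) ℝ}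
    (hA1 : A1.IsSymm) (hA2 : A2.IsSymm) (hB : B.PosSemidef) (hBB : B * B = B)
    (hrank : ∀ x : Fin 2 → ℝ, (B - ∑ i, x i • ![A1, A2] i).PosSemidef →
      (B - ∑ i, x i • ![A1, A2] i).rank ≤ B.rank)
    {c : Fin 2 → ℝ} (hgap : valP ![A1, A2] B c < valD ![A1, A2] B c) :
    ∃ (T : Matrix (Fin n) (Fin n) ℝ) (V : Matrix (Fin 2) (Fin 2) ℝ), IsUnit T ∧ IsUnit V ∧
      StandardFormSys (Tᵀ * (V 0 0 • A1 + V 0 1 • A2) * T)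
        (Tᵀ * (V 1 0 • A1 + V 1 1 • A2) * T) (Tᵀ * B * T) := by
  have hA : ∀ i, (![A1, A2] i).IsSymm := Fin.forall_fin_two.2 ⟨hA1, hA2⟩
  obtain ⟨x, hx, hxpsd, hcx⟩ := exists_ne_zero_posSemidef_of_valP_lt_valD hA hB hgap
  simp only [Fin.sum_univ_two, cons_val_zero, cons_val_one] at hxpsd hcx hrank
  have hP : ∀ y : Fin 2 → ℝ, (B - (y 0 • A1 + y 1 • A2)).PosSemidef →
      ((c 0 * y 0 + c 1 * y 1 : ℝ) : EReal) ≤ valP ![A1, A2] B c := fun y hy =>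
    le_sSup ⟨y, by simpa [Fin.sum_univ_two] using hy, by simp [Fin.sum_univ_two]⟩
  have hD : ∀ Y : Matrix (Fin n) (Fin n) ℝ, Y.PosSemidef → (A1 * Y).trace = c 0 →
      (A2 * Y).trace = c 1 → valD ![A1, A2] B c ≤ ((B * Y).trace : ℝ) := fun Y hY h0 h1 =>
    sInf_le ⟨Y, ⟨hY, Fin.forall_fin_two.2 ⟨h0, h1⟩⟩, rfl⟩
  have hP0 : (0 : EReal) ≤ valP ![A1, A2] B c := by simpa using hP 0 (by simpa using hB)
  obtain ⟨v₁, hPv₁, hv₁D⟩ := EReal.lt_iff_exists_real_btwn.1 hgap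
  obtain ⟨v₂, hv₁₂, hv₂D⟩ := EReal.lt_iff_exists_real_btwn.1 hv₁D
  have hv₁ : 0 < v₁ := EReal.coe_pos.1 (hP0.trans_lt hPv₁)
  rw [EReal.coe_lt_coe_iff] at hv₁₂
  have hv₂ : 0 < v₂ := hv₁.trans hv₁₂
  have hγ : 0 < c 0 * c 0 + c 1 * c 1 := by
    refine lt_of_le_of_ne (add_nonneg (mul_self_nonneg _) (mul_self_nonneg _)) fun h => ?_
    obtain ⟨h0, h1⟩ := mul_self_add_mul_self_eq_zero.1 h.symm
    have := hD 0 .zero (by simp [h0]) (by simp [h1])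
    exact (hP0.trans_lt hgap).not_ge (by simpa using this)
  have hxx : 0 < x 0 * x 0 + x 1 * x 1 := by
    refine lt_of_le_of_ne (add_nonneg (mul_self_nonneg _) (mul_self_nonneg _)) fun h => hx ?_
    obtain ⟨h0, h1⟩ := mul_self_add_mul_self_eq_zero.1 h.symm
    exact funext (Fin.forall_fin_two.2 ⟨h0, h1⟩)
  have hV : IsUnit (!![x 0, x 1; c 0, c 1]) := by
    rw [isUnit_iff_isUnit_det, det_fin_two_of, isUnit_iff_ne_zero]
    intro h
    have : (x 0 * x 0 + x 1 * x 1) * (c 0 * c 0 + c 1 * c 1) = 0 := by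
      linear_combination (x 0 * c 1 - x 1 * c 0) * h + (c 0 * x 0 + c 1 * x 1) * hcx
    exact (mul_pos hxx hγ).ne' this
  have hker : ∀ v, B *ᵥ v = 0 → (x 0 • A1 + x 1 • A2) *ᵥ v = 0 := fun v =>
    hxpsd.mulVec_eq_zero_of_rank_add_le hB <| by
      have h := hrank (-x)
      have heq : B - ((-x) 0 • A1 + (-x) 1 • A2) = B + (x 0 • A1 + x 1 • A2) := by
        simp only [Pi.neg_apply]
        module
      rw [heq] at h
      exact h (hB.add hxpsd)
  have hbound : ∀ v, (x 0 • A1 + x 1 • A2) *ᵥ v = 0 → v ⬝ᵥ (c 0 • A1 + c 1 • A2) *ᵥ v ≤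
      (c 0 * c 0 + c 1 * c 1) / v₂ * (v ⬝ᵥ B *ᵥ v) := fun v hv => by
    have hvB := hB.dotProduct_mulVec_nonneg v
    rw [star_trivial] at hvB
    rcases le_or_gt (v ⬝ᵥ (c 0 • A1 + c 1 • A2) *ᵥ v) 0 with hq | hq
    · exact hq.trans (by positivity)
    have hxv : x 0 * (v ⬝ᵥ A1 *ᵥ v) + x 1 * (v ⬝ᵥ A2 *ᵥ v) = 0 := by
      simpa [add_mulVec, smul_mulVec] using congrArg (v ⬝ᵥ ·) hv
    have hcv : c 0 * (v ⬝ᵥ A1 *ᵥ v) + c 1 * (v ⬝ᵥ A2 *ᵥ v) =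
        v ⬝ᵥ (c 0 • A1 + c 1 • A2) *ᵥ v := by
      simp [add_mulVec, smul_mulVec]
    set q := v ⬝ᵥ (c 0 • A1 + c 1 • A2) *ᵥ v
    set γ := c 0 * c 0 + c 1 * c 1
    have hcross : (v ⬝ᵥ A1 *ᵥ v) * c 1 - (v ⬝ᵥ A2 *ᵥ v) * c 0 = 0 := by
      refine (mul_eq_zero.1 ?_).resolve_left hxx.ne'
      linear_combination (x 0 * c 1 - x 1 * c 0) * hxv +
        (x 1 * (v ⬝ᵥ A1 *ᵥ v) - x 0 * (v ⬝ᵥ A2 *ᵥ v)) * hcx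
    have h := hv₂D.trans_le (hD ((γ / q) • vecMulVec v v)
      ((posSemidef_vecMulVec_self v).smul (by positivity))
      (by
        rw [Matrix.mul_smul, trace_smul, trace_mul_vecMulVec_self, smul_eq_mul, div_mul_eq_mul_div,
          div_eq_iff hq.ne']
        linear_combination c 1 * hcross + c 0 * hcv)
      (by
        rw [Matrix.mul_smul, trace_smul, trace_mul_vecMulVec_self, smul_eq_mul, div_mul_eq_mul_div,
          div_eq_iff hq.ne']
        linear_combination -c 0 * hcross + c 1 * hcv))
    rw [EReal.coe_lt_coe_iff, Matrix.mul_smul, trace_smul, trace_mul_vecMulVec_self, smul_eq_mul,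
      div_mul_eq_mul_div, lt_div_iff₀ hq] at h
    rw [div_mul_eq_mul_div, le_div_iff₀ hv₂]
    linarith
  obtain ⟨T, hT, h⟩ := exists_standardFormSys_of_forall_not_posSemidef hxpsd
    ((hA1.smul (c 0)).add (hA2.smul (c 1))) hB hBB hker (div_pos hv₁ hγ)
    (by rwa [div_mul_div_cancel₀ hγ.ne', div_lt_one hv₂]) hbound fun α hα => by
      have heq : B - (v₁ / (c 0 * c 0 + c 1 * c 1)) • (c 0 • A1 + c 1 • A2) +
          α • (x 0 • A1 + x 1 • A2) = B -
          (((v₁ / (c 0 * c 0 + c 1 * c 1)) • c - α • x) 0 • A1 +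
            ((v₁ / (c 0 * c 0 + c 1 * c 1)) • c - α • x) 1 • A2) := by
        simp only [Pi.sub_apply, Pi.smul_apply, smul_eq_mul]
        module
      rw [heq] at hα
      refine (hPv₁.trans_le ?_).not_ge (hP _ hα)
      rw [EReal.coe_le_coe_iff]
      simp only [Pi.sub_apply, Pi.smul_apply, smul_eq_mul]
      refine le_of_eq ?_
      have := div_mul_cancel₀ v₁ hγ.ne'
      linear_combination α * hcx - this
  exact ⟨T, !![x 0, x 1; c 0, c 1], hT, hV, by simpa using h⟩

/-- (Characterization of "really badly behaved" two-variable semidefinite systems.)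
Under the standing assumptions, there is an objective vector `c ∈ ℝ²` producing a
positive duality gap iff the system `x₁A₁ + x₂A₂ ⪯ B` has a reformulation in
standard form. -/
theorem twoVar_system_gap_characterization {n r : ℕ}
    (A1 A2 B : Matrix (Fin n) (Fin n) ℝ)
    (hA1 : A1.IsSymm) (hA2 : A2.IsSymm)
    (hind : LinearIndependent ℝ ![A1, A2, B])
    (hrn : r < n)
    (hB : ∀ a b : Fin n, B a b = if a = b ∧ a.val < r then 1 else 0)
    (hfeas : ∃ x : Fin 2 → ℝ, (B - ∑ i, x i • ![A1, A2] i).PosSemidef)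
    (hmaxrank : ∀ x : Fin 2 → ℝ, (B - ∑ i, x i • ![A1, A2] i).PosSemidef →
      (B - ∑ i, x i • ![A1, A2] i).rank ≤ r) :
    (∃ c : Fin 2 → ℝ, valP ![A1, A2] B c < valD ![A1, A2] B c) ↔
    (∃ (T : Matrix (Fin n) (Fin n) ℝ) (V : Matrix (Fin 2) (Fin 2) ℝ) (μ : Fin 2 → ℝ),
      IsUnit T ∧ IsUnit V ∧
      StandardFormSys
        (Tᵀ * (V 0 0 • A1 + V 0 1 • A2) * T)
        (Tᵀ * (V 1 0 • A1 + V 1 1 • A2) * T)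
        (Tᵀ * (B + μ 0 • A1 + μ 1 • A2) * T)) := by
  have hBdiag : B = diagonal fun a : Fin n => if a.val < r then (1 : ℝ) else 0 := by
    ext a b
    rw [hB, diagonal_apply, ite_and]
  have hBpsd : B.PosSemidef := by
    rw [hBdiag, posSemidef_diagonal_iff]
    exact fun a => by positivity
  have hBB : B * B = B := by
    rw [hBdiag, diagonal_mul_diagonal]
    simp
  have hBrank : B.rank = r := by
    rw [hBdiag, rank_diagonal]
    simp [Fintype.card_subtype, Fin.card_filter_val_lt, hrn.le]
  constructor
  · rintro ⟨c, hgap⟩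
    obtain ⟨T, V, hT, hV, h⟩ := exists_standardFormSys_of_valP_lt_valD hA1 hA2 hBpsd hBB
      (fun x hx => hBrank ▸ hmaxrank x hx) hgap
    exact ⟨T, V, 0, hT, hV, by simpa using h⟩
  · rintro ⟨T, V, μ, hT, hV, h⟩
    exact exists_valP_lt_valD_of_standardFormSys hT hV h
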